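/- Let c : X* → ℝ be a rational series with linear representation (μ, γ, λ) of dimension n (so (c,η) = λ μ(η) γ for all η ∈ X*), and fix a submultiplicative matrix norm ‖·‖. If û is a sequence with ‖û‖_∞ < ( Σ_{j=0}^m ‖μ(x_j)‖ )^{-1}, then for every N ≥ 1: (i) the series F̂_c[û](N) = Σ_η (c,η) S_η[û](N) converges absolutely; (ii) for each N ≥ 1 the matrix I − Σ_{j=0}^m û_j(N) μ(x_j) is invertible; and (iii) F̂_c[û](N) = λ z(N), where z(0) = γ and z(N) = (I − Σ_{j=0}^m û_j(N) μ(x_j))^{-1} z(N−1) for N ≥ 1. In particular, F̂_c has a finite-dimensional rational-input, state-affine realization with linear output map. -/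

import Mathlib

open scoped BigOperators

namespace FliessStmt

/-- Words over the alphabet `X = {x_0, …, x_m}`. -/
abbrev Word (m : ℕ) := List (Fin (m + 1))

noncomputable section

/-- Iterated sums: `S_∅[û](N) = 1`,
`S_{x_i η}[û](N) = Σ_{k=1}^N û_i(k) S_η[û](k)`. -/
def itS (m : ℕ) (u : ℕ → Fin (m + 1) → ℝ) : Word m → ℕ → ℝ
  | [], _ => 1
  | i :: η, N => ∑ k ∈ Finset.Icc 1 N, u k i * itS m u η k

/-- The recursion in the time variable satisfied by the iterated sums. -/
theorem itS_cons_succ (m : ℕ) (u : ℕ → Fin (m + 1) → ℝ) (i : Fin (m + 1)) (η : Word m) (N : ℕ) :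
    itS m u (i :: η) (N + 1) = itS m u (i :: η) N + u (N + 1) i * itS m u η (N + 1) := by
  simp only [itS]
  rw [Finset.sum_Icc_succ_top (by omega)]

theorem itS_cons_zero (m : ℕ) (u : ℕ → Fin (m + 1) → ℝ) (i : Fin (m + 1)) (η : Word m) :
    itS m u (i :: η) 0 = 0 := by
  simp [itS]

/-- A geometric bound on iterated sums: enlarging the input bound by any factor `r > 1` absorbs
the polynomial growth in the word length. -/
theorem abs_itS_le (m : ℕ) (u : ℕ → Fin (m + 1) → ℝ) {U r : ℝ} (hU : 0 ≤ U) (hr : 1 < r)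
    (hu : ∀ N, 1 ≤ N → ∀ i, |u N i| ≤ U) (η : Word m) (N : ℕ) :
    |itS m u η N| ≤ (r * U) ^ η.length * (r / (r - 1)) ^ N := by
  have hr' : 0 < r - 1 := by linarith
  have hC : 1 ≤ r / (r - 1) := by rw [le_div_iff₀ hr']; linarith
  induction η generalizing N with
  | nil => simpa [itS] using one_le_pow₀ hC
  | cons i η ih =>
    induction N with
    | zero => rw [itS_cons_zero]; simp only [abs_zero]; positivity
    | succ N ihN =>
      rw [itS_cons_succ]
      calc |itS m u (i :: η) N + u (N + 1) i * itS m u η (N + 1)|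
          ≤ |itS m u (i :: η) N| + |u (N + 1) i| * |itS m u η (N + 1)| := by
            rw [← abs_mul]; exact abs_add_le _ _
        _ ≤ (r * U) ^ (i :: η).length * (r / (r - 1)) ^ N
            + U * ((r * U) ^ η.length * (r / (r - 1)) ^ (N + 1)) := by
            gcongr
            · exact hu _ (by omega) _
            · exact ih _
        _ = (r * U) ^ (i :: η).length * (r / (r - 1)) ^ (N + 1) := by
            simp only [List.length_cons, pow_succ]
            field_simp
            ring

/-- Multiplicative nonnegative weights on words are summable if the letter weights sum to less
than one. -/
theorem summable_list_prod {α : Type*} [Fintype α] {w : α → ℝ} (hw : ∀ a, 0 ≤ w a)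
    (hsum : ∑ a, w a < 1) : Summable (fun l : List α => (l.map w).prod) := by
  rw [← (List.equivSigmaTuple (α := α)).symm.summable_iff]
  have heq : (fun l : List α => (l.map w).prod) ∘ (List.equivSigmaTuple (α := α)).symm
      = fun p : Σ n, Fin n → α => ∏ i, w (p.2 i) := by
    funext p
    simp [List.equivSigmaTuple, List.map_ofFn, List.prod_ofFn]
  rw [heq, summable_sigma_of_nonneg fun p => Finset.prod_nonneg fun i _ => hw _]
  refine ⟨fun n => Summable.of_finite, ?_⟩
  have hpow : ∀ n : ℕ, ∑' f : Fin n → α, ∏ i, w (f i) = (∑ a, w a) ^ n := fun n => by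
    rw [tsum_fintype, Fintype.sum_pow]
  simp only [hpow]
  exact summable_geometric_of_lt_one (Finset.sum_nonneg fun a _ => hw a) hsum

theorem norm_list_prod_le_norm_one_mul {A α : Type*} [NormedRing A] (μ : α → A) (l : List α) :
    ‖(l.map μ).prod‖ ≤ ‖(1 : A)‖ * (l.map fun a => ‖μ a‖).prod := by
  induction l with
  | nil => simp
  | cons a l ih =>
    simp only [List.map_cons, List.prod_cons]
    calc ‖μ a * (l.map μ).prod‖ ≤ ‖μ a‖ * ‖(l.map μ).prod‖ := norm_mul_le _ _
      _ ≤ ‖μ a‖ * (‖(1 : A)‖ * (l.map fun a => ‖μ a‖).prod) := by gcongr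
      _ = _ := by ring

section NormedAlgebra

variable {A : Type*} [NormedRing A] [NormedAlgebra ℝ A] {m : ℕ} {μ : Fin (m + 1) → A}
  {u : ℕ → Fin (m + 1) → ℝ} {U : ℝ}

/-- The generating series of the iterated sums converges absolutely for small inputs. -/
theorem summable_norm_itS_smul (hU : 0 ≤ U) (hu : ∀ N, 1 ≤ N → ∀ i, |u N i| ≤ U)
    (hlt : U * ∑ j, ‖μ j‖ < 1) (N : ℕ) :
    Summable (fun η : Word m => ‖itS m u η N • (η.map μ).prod‖) := by
  set ρ := U * ∑ j, ‖μ j‖ with hρ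
  have hρ0 : 0 ≤ ρ := mul_nonneg hU (Finset.sum_nonneg fun _ _ => norm_nonneg _)
  obtain ⟨r, hr, hrρ⟩ : ∃ r : ℝ, 1 < r ∧ r * ρ < 1 := by
    refine ⟨2 / (1 + ρ), ?_, ?_⟩
    · rw [lt_div_iff₀ (by linarith)]; linarith
    · rw [div_mul_eq_mul_div, div_lt_one (by linarith)]; linarith
  have hrU : 0 ≤ r * U := by positivity
  have hs := summable_list_prod (w := fun j => r * U * ‖μ j‖)
    (fun j => by positivity) (by rw [← Finset.mul_sum, mul_assoc]; exact hrρ)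
  refine Summable.of_nonneg_of_le (fun _ => norm_nonneg _) (fun η => ?_)
    (hs.mul_left ((r / (r - 1)) ^ N * ‖(1 : A)‖))
  have hr' : 0 < r - 1 := by linarith
  rw [norm_smul, Real.norm_eq_abs, List.prod_map_mul, List.map_const', List.prod_replicate]
  calc |itS m u η N| * ‖(η.map μ).prod‖
      ≤ ((r * U) ^ η.length * (r / (r - 1)) ^ N) *
        (‖(1 : A)‖ * (η.map fun a => ‖μ a‖).prod) := by
        gcongr
        · exact abs_itS_le m u hU hr hu η N
        · exact norm_list_prod_le_norm_one_mul μ η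
    _ = _ := by ring

theorem tsum_itS_zero_smul : ∑' η : Word m, itS m u η 0 • (η.map μ).prod = 1 := by
  rw [tsum_eq_single []]
  · simp [itS]
  · rintro (_ | ⟨i, η⟩) h
    · exact absurd rfl h
    · rw [itS_cons_zero, zero_smul]

/-- The generating series of the iterated sums satisfies the implicit state equation. -/
theorem one_sub_mul_tsum_itS_smul [CompleteSpace A]
    (hs : ∀ N, Summable (fun η : Word m => itS m u η N • (η.map μ).prod)) (N : ℕ) :
    (1 - ∑ j, u (N + 1) j • μ j) * ∑' η : Word m, itS m u η (N + 1) • (η.map μ).prod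
      = ∑' η : Word m, itS m u η N • (η.map μ).prod := by
  have hsub := (hs (N + 1)).tsum_sub (hs N)
  set D : Word m → A := fun η =>
    itS m u η (N + 1) • (η.map μ).prod - itS m u η N • (η.map μ).prod with hD
  have hDs : Summable D := (hs (N + 1)).sub (hs N)
  let g : Fin (m + 1) × Word m → Word m := fun p => p.1 :: p.2
  have hg : Function.Injective g := by
    rintro ⟨i, η⟩ ⟨j, θ⟩ h
    simpa [g] using h
  have hsupp : Function.support D ⊆ Set.range g := by
    rintro (_ | ⟨i, η⟩) h
    · simp [hD, itS] at h
    · exact ⟨(i, η), rfl⟩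
  have hDg : ∀ i η, D (g (i, η))
      = (u (N + 1) i • μ i) * (itS m u η (N + 1) • (η.map μ).prod) := fun i η => by
    simp only [hD, g, itS_cons_succ, List.map_cons, List.prod_cons, add_smul,
      add_sub_cancel_left, smul_mul_smul_comm]
  have key : ∑' η, D η
      = (∑ j, u (N + 1) j • μ j) * ∑' η : Word m, itS m u η (N + 1) • (η.map μ).prod := by
    rw [← hg.tsum_eq hsupp, Summable.tsum_prod (f := fun p => D (g p)) (hDs.comp_injective hg),
      tsum_fintype, Finset.sum_mul]
    refine Finset.sum_congr rfl fun i _ => ?_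
    simp only [hDg]
    exact (hs (N + 1)).tsum_mul_left _
  rw [sub_mul, one_mul, ← key, hsub, sub_sub_cancel]

theorem isUnit_one_sub_sum_smul [CompleteSpace A] {v : Fin (m + 1) → ℝ} (hv : ∀ i, |v i| ≤ U)
    (hlt : U * ∑ j, ‖μ j‖ < 1) : IsUnit (1 - ∑ j, v j • μ j) := by
  refine isUnit_one_sub_of_norm_lt_one (lt_of_le_of_lt ?_ hlt)
  rw [Finset.mul_sum]
  refine norm_sum_le_of_le _ fun j _ => ?_
  rw [norm_smul, Real.norm_eq_abs]
  gcongr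
  exact hv j

/-- The state-affine realization in an abstract finite-dimensional normed algebra. -/
theorem exists_realization [FiniteDimensional ℝ A] (hU : 0 ≤ U)
    (hu : ∀ N, 1 ≤ N → ∀ i, |u N i| ≤ U) (hlt : U * ∑ j, ‖μ j‖ < 1) :
    (∀ N, 1 ≤ N → IsUnit (1 - ∑ j, u N j • μ j)) ∧
    ∃ Z : ℕ → A, Z 0 = 1 ∧
      (∀ N, (1 - ∑ j, u (N + 1) j • μ j) * Z (N + 1) = Z N) ∧
      ∀ (f : A →ₗ[ℝ] ℝ) (N : ℕ),
        Summable (fun η : Word m => |f (η.map μ).prod * itS m u η N|) ∧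
        ∑' η : Word m, f (η.map μ).prod * itS m u η N = f (Z N) := by
  have : CompleteSpace A := FiniteDimensional.complete ℝ A
  have hs : ∀ N, Summable (fun η : Word m => itS m u η N • (η.map μ).prod) :=
    fun N => (summable_norm_itS_smul hU hu hlt N).of_norm
  refine ⟨fun N hN => isUnit_one_sub_sum_smul (hu N hN) hlt,
    fun N => ∑' η : Word m, itS m u η N • (η.map μ).prod, tsum_itS_zero_smul,
    one_sub_mul_tsum_itS_smul hs, fun f N => ?_⟩
  have h := (hs N).hasSum.mapL (LinearMap.toContinuousLinearMap f)
  have heq : (fun η : Word m => f (η.map μ).prod * itS m u η N)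
      = fun η => LinearMap.toContinuousLinearMap f (itS m u η N • (η.map μ).prod) := by
    funext η
    simp [mul_comm]
  rw [← heq] at h
  exact ⟨h.summable.abs, h.tsum_eq⟩

end NormedAlgebra

open Matrix in
/-- If `c` is rational with linear representation `(μ, γ, λ)` of
dimension `n`, `‖·‖` is a submultiplicative matrix norm, and
`‖û‖_∞ ≤ U < (Σ_j ‖μ(x_j)‖)⁻¹`, then for every `N ≥ 1`: (i) `F̂_c[û](N)` converges
absolutely; (ii) `I − Σ_j û_j(N) μ(x_j)` is invertible; (iii) `F̂_c[û](N) = λ z(N)`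
where `z(0) = γ` and `(I − Σ_j û_j(N) μ(x_j)) z(N) = z(N−1)`, i.e. `F̂_c` has a
finite-dimensional rational-input, state-affine realization with linear output. -/
theorem rational_state_affine_realization (m n : ℕ)
    (μ : Fin (m + 1) → Matrix (Fin n) (Fin n) ℝ) (lam γ : Fin n → ℝ)
    (c : Word m → ℝ)
    (hc : ∀ η : Word m, c η = lam ⬝ᵥ ((η.map μ).prod).mulVec γ)
    (nrm : Matrix (Fin n) (Fin n) ℝ → ℝ)
    (hnn : ∀ A, 0 ≤ nrm A) (hzero : ∀ A, nrm A = 0 ↔ A = 0)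
    (hadd : ∀ A B, nrm (A + B) ≤ nrm A + nrm B)
    (hsmul : ∀ (r : ℝ) A, nrm (r • A) = |r| * nrm A)
    (hmul : ∀ A B, nrm (A * B) ≤ nrm A * nrm B)
    (u : ℕ → Fin (m + 1) → ℝ) (U : ℝ)
    (hu : ∀ N, 1 ≤ N → ∀ i, |u N i| ≤ U)
    (hU : U < (∑ j : Fin (m + 1), nrm (μ j))⁻¹) :
    (∀ N : ℕ, 1 ≤ N → Summable (fun η : Word m => |c η * itS m u η N|)) ∧
    (∀ N : ℕ, 1 ≤ N → IsUnit (1 - ∑ j : Fin (m + 1), u N j • μ j)) ∧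
    ∃ z : ℕ → Fin n → ℝ, z 0 = γ ∧
      (∀ N : ℕ, 1 ≤ N → (1 - ∑ j : Fin (m + 1), u N j • μ j).mulVec (z N) = z (N - 1)) ∧
      (∀ N : ℕ, 1 ≤ N → ∑' η : Word m, c η * itS m u η N = lam ⬝ᵥ z N) := by
  have hU0 : 0 ≤ U := (abs_nonneg _).trans (hu 1 le_rfl 0)
  have hlt : U * ∑ j, nrm (μ j) < 1 := by
    rcases (Finset.sum_nonneg fun j _ => hnn (μ j) : 0 ≤ ∑ j, nrm (μ j)).eq_or_lt with h | h
    · rw [← h]; simp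
    · rwa [← lt_div_iff₀ h, one_div]
  let rn : RingNorm (Matrix (Fin n) (Fin n) ℝ) :=
    { toFun := nrm
      map_zero' := (hzero 0).2 rfl
      add_le' := hadd
      neg' := fun A => by simpa using hsmul (-1) A
      mul_le' := hmul
      eq_zero_of_map_eq_zero' := fun A => (hzero A).1 }
  let _ : NormedRing (Matrix (Fin n) (Fin n) ℝ) := rn.toNormedRing
  let _ : NormedAlgebra ℝ (Matrix (Fin n) (Fin n) ℝ) :=
    { (inferInstance : Algebra ℝ (Matrix (Fin n) (Fin n) ℝ)) with
      norm_smul_le := fun r A => (hsmul r A).le }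
  obtain ⟨hunit, Z, hZ0, hZ, hf⟩ := exists_realization (μ := μ) (u := u) hU0 hu hlt
  let f : Matrix (Fin n) (Fin n) ℝ →ₗ[ℝ] ℝ :=
    { toFun := fun M => lam ⬝ᵥ M.mulVec γ
      map_add' := fun M M' => by rw [Matrix.add_mulVec, dotProduct_add]
      map_smul' := fun r M => by rw [Matrix.smul_mulVec, dotProduct_smul]; rfl }
  have hcf : ∀ η : Word m, c η = f (η.map μ).prod := hc
  simp only [hcf]
  refine ⟨fun N _ => (hf f N).1, hunit, fun N => (Z N).mulVec γ, ?_, ?_, fun N _ => (hf f N).2⟩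
  · simp [hZ0]
  · intro N hN
    obtain ⟨k, rfl⟩ : ∃ k, N = k + 1 := ⟨N - 1, by omega⟩
    rw [Matrix.mulVec_mulVec]
    exact congrArg (fun M => Matrix.mulVec M γ) (hZ k)

end

end FliessStmt
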